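/- For every integer k ≥ 1, the Hankel determinant H_{f_{2k+3}/2 + f_{2k} + 1, f_{2k+1}} equals f_{2k}. -/

import Mathlib

/-- The substitution τ: 1 → 101, 0 → 1 on the alphabet {0,1}. -/
def tau (b : ℕ) : List ℕ := if b = 1 then [1, 0, 1] else [1]

/-- The iterated word τ^n(1). -/
def tauIter : ℕ → List ℕ
  | 0 => [1]
  | n + 1 => ((tauIter n).map tau).flatten

/-- `s` is the fixed point of τ beginning with 1: it agrees with every
iterate `τ^n(1)` on its length. -/
def IsFixedSeq (s : ℕ → ℕ) : Prop :=
  ∀ n j, j < (tauIter n).length → s j = (tauIter n).getD j 0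

/-- The sequence (f_n): f_0 = 1, f_1 = 2, f_{2n+2} = f_{2n} + f_{2n+1},
f_{2n+3} = f_{2n} + f_{2n+2}. -/
def IsFSeq (f : ℕ → ℕ) : Prop :=
  f 0 = 1 ∧ f 1 = 2 ∧ (∀ n, f (2*n+2) = f (2*n) + f (2*n+1)) ∧
    (∀ n, f (2*n+3) = f (2*n) + f (2*n+2))

/-- `a` is the f-representation of `n`: digits in {0,1}, finitely supported,
a_i a_{i+1} = 0 for all i, a_i a_{i+2} = 0 for even i, and n = Σ a_i f_i. -/
def IsFRep (f : ℕ → ℕ) (n : ℕ) (a : ℕ → ℕ) : Prop :=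
  (∀ i, a i ≤ 1) ∧ (∀ i, a i * a (i+1) = 0) ∧
  (∀ i, Even i → a i * a (i+2) = 0) ∧
  ∃ N, (∀ i, N ≤ i → a i = 0) ∧ n = ∑ i ∈ Finset.range N, a i * f i

/-- The truncated f-representation Φ_k(n) = Σ_{i=0}^{2k+2} a_i(n) f_i. -/
def Phi (f : ℕ → ℕ) (a : ℕ → ℕ → ℕ) (k n : ℕ) : ℕ :=
  ∑ i ∈ Finset.range (2*k+3), a n i * f i

/-- The Hankel determinant H_{m,n} = det (s_{m+i+j})_{0 ≤ i,j ≤ n-1}. -/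
def H (s : ℕ → ℕ) (m n : ℕ) : ℤ :=
  (Matrix.of fun i j : Fin n => (s (m + i.1 + j.1) : ℤ)).det


/-- Indicator of a cyclic interval, as a circulant matrix. -/
def circInt (n h : ℕ) : Matrix (ZMod n) (ZMod n) ℚ :=
  Matrix.of fun u v => if (u - v).val < h then 1 else 0

/-- `P^a - 1 + t J`. -/
def circB (n : ℕ) (t : ℚ) (a : ZMod n) : Matrix (ZMod n) (ZMod n) ℚ :=
  Matrix.of fun u v => (if u - v = a then 1 else 0) - (if u = v then 1 else 0) + t

lemma card_val_lt (n h : ℕ) [NeZero n] (hn : h ≤ n) :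
    (Finset.univ.filter fun x : ZMod n => x.val < h).card = h := by
  have : (Finset.univ.filter fun x : ZMod n => x.val < h) =
      (Finset.range h).image (fun i : ℕ => (i : ZMod n)) := by
    ext x
    simp only [Finset.mem_filter, Finset.mem_univ, true_and, Finset.mem_image, Finset.mem_range]
    constructor
    · intro hx
      exact ⟨x.val, hx, by simp⟩
    · rintro ⟨i, hi, rfl⟩
      rw [ZMod.val_cast_of_lt (by omega)]
      exact hi
  rw [this, Finset.card_image_of_injOn]
  · simp
  · intro i hi j hj hij
    simp only [Finset.coe_range, Set.mem_Iio] at hi hj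
    have := congrArg ZMod.val hij
    rwa [ZMod.val_cast_of_lt (by omega), ZMod.val_cast_of_lt (by omega)] at this

lemma circInt_row (n h : ℕ) [NeZero n] (hn : h ≤ n) (u : ZMod n) :
    ∑ w, circInt n h u w = h := by
  unfold circInt
  simp only [Matrix.of_apply]
  refine ((Equiv.subLeft u).sum_comp
    (fun x : ZMod n => if x.val < h then (1 : ℚ) else 0)).trans ?_
  rw [Finset.sum_boole, card_val_lt n h hn]

lemma val_sub_one_lt (n h : ℕ) [NeZero n] (h0 : 0 < h) (hn : h < n) (x : ZMod n) :
    ((if (x - 1).val < h then (1:ℚ) else 0) - (if x.val < h then 1 else 0))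
      = (if x = (h : ZMod n) then 1 else 0) - (if x = 0 then 1 else 0) := by
  obtain ⟨i, hi, rfl⟩ : ∃ i : ℕ, i < n ∧ x = (i : ZMod n) := ⟨x.val, x.val_lt, by simp⟩
  have e1 : ((i : ZMod n) = (h : ZMod n)) ↔ i = h := by
    constructor
    · intro e
      have := congrArg ZMod.val e
      rwa [ZMod.val_cast_of_lt hi, ZMod.val_cast_of_lt hn] at this
    · rintro rfl; rfl
  have e2 : ((i : ZMod n) = 0) ↔ i = 0 := by
    constructor
    · intro e
      have := congrArg ZMod.val e
      rwa [ZMod.val_cast_of_lt hi, ZMod.val_zero] at this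
    · rintro rfl; simp
  rw [ZMod.val_cast_of_lt hi]
  simp only [e1, e2]
  rcases Nat.eq_zero_or_pos i with rfl | hp
  · have : ((0 : ℕ) : ZMod n) - 1 = ((n - 1 : ℕ) : ZMod n) := by
      rw [Nat.cast_sub (by omega)]; simp
    rw [this, ZMod.val_cast_of_lt (by omega)]
    rw [if_neg (by omega), if_pos h0, if_neg (by omega), if_pos rfl]
  · have : (i : ZMod n) - 1 = ((i - 1 : ℕ) : ZMod n) := by
      rw [Nat.cast_sub (by omega)]; simp
    rw [this, ZMod.val_cast_of_lt (by omega)]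
    by_cases c : i = h
    · subst c
      rw [if_pos (by omega), if_neg (by omega), if_pos rfl, if_neg (by omega)]
    · rw [if_neg c, if_neg (by omega : ¬ i = 0)]
      by_cases d : i < h
      · rw [if_pos (by omega), if_pos d]; simp
      · rw [if_neg (by omega), if_neg d]

lemma circ_mul (n h : ℕ) [NeZero n] (h0 : 0 < h) (hn : h < n) :
    circInt n h * circB n 1 1 = circB n h (h : ZMod n) := by
  ext u v
  rw [Matrix.mul_apply]
  have : ∀ w, circInt n h u w * circB n 1 1 w v =
      (if w = v + 1 then circInt n h u w else 0) - (if w = v then circInt n h u w else 0)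
        + circInt n h u w := by
    intro w
    simp only [circB, Matrix.of_apply, sub_eq_iff_eq_add, add_comm (1 : ZMod n) v]
    split_ifs <;> ring
  rw [Finset.sum_congr rfl (fun w _ => this w), Finset.sum_add_distrib, Finset.sum_sub_distrib,
    circInt_row n h hn.le]
  simp only [Finset.sum_ite_eq', Finset.mem_univ, if_true]
  have key := val_sub_one_lt n h h0 hn (u - v)
  simp only [circInt, circB, Matrix.of_apply]
  rw [← sub_sub, key]
  simp only [sub_eq_zero]

lemma circB_unit (n h : ℕ) [NeZero n] (hc : Nat.Coprime h n) (t : ℚ) :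
    (circB n t (h : ZMod n)).det = (circB n t 1).det := by
  have hu : ((ZMod.unitOfCoprime h hc : (ZMod n)ˣ) : ZMod n) = h := ZMod.coe_unitOfCoprime h hc
  rw [← Matrix.det_submatrix_equiv_self (Units.mulLeft (ZMod.unitOfCoprime h hc))]
  congr 1
  ext u v
  simp only [Matrix.submatrix_apply, circB, Matrix.of_apply, Units.mulLeft_apply]
  have i1 : ((ZMod.unitOfCoprime h hc : (ZMod n)ˣ) : ZMod n) * u
      - (ZMod.unitOfCoprime h hc : (ZMod n)ˣ) * v = (h : ZMod n) ↔ u - v = 1 := by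
    rw [← mul_sub, ← hu]
    constructor
    · intro e
      have := (ZMod.unitOfCoprime h hc).isUnit.mul_left_cancel (e.trans (mul_one _).symm)
      exact this
    · intro e; rw [e, mul_one]
  simp only [i1, Units.mul_right_inj]

lemma circB_scale (n h : ℕ) [NeZero n] :
    (circB n h 1).det = h * (circB n 1 1).det := by
  have hn : (n : ℚ) ≠ 0 := by exact_mod_cast NeZero.ne n
  have hmul : circB n h 1 = circB n 1 1 *
      (1 + Matrix.replicateCol Unit (fun _ : ZMod n => ((h : ℚ) - 1) / n) * Matrix.replicateRow Unit (fun _ => (1 : ℚ))) := by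
    ext u v
    rw [Matrix.mul_add, Matrix.mul_one, Matrix.add_apply, Matrix.mul_apply]
    have : ∀ w, circB n 1 1 u w * (Matrix.replicateCol Unit (fun _ : ZMod n => ((h : ℚ) - 1) / n) *
        Matrix.replicateRow Unit (fun _ => (1 : ℚ))) w v = ((if w = u - 1 then 1 else 0) - (if w = u then 1 else 0) + 1) * (((h : ℚ) - 1) / n) := by
      intro w
      have i1 : u - w = 1 ↔ w = u - 1 := by
        constructor
        · intro e; rw [← e]; ring
        · intro e; rw [e]; ring
      simp [Matrix.mul_apply, circB, i1, eq_comm]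
    rw [Finset.sum_congr rfl (fun w _ => this w), ← Finset.sum_mul, Finset.sum_add_distrib,
      Finset.sum_sub_distrib]
    simp [circB, ZMod.card]
    field_simp
    ring
  rw [hmul, Matrix.det_mul, Matrix.det_one_add_replicateCol_mul_replicateRow]
  simp [_root_.dotProduct, ZMod.card]
  field_simp
  ring

lemma circB_ne (n : ℕ) [NeZero n] : (circB n 1 1).det ≠ 0 := by
  have hn : (n : ℚ) ≠ 0 := by exact_mod_cast NeZero.ne n
  intro hdet
  obtain ⟨v, hv, hz⟩ := Matrix.exists_mulVec_eq_zero_iff.mpr hdet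
  have key : ∀ u, v (u - 1) - v u + ∑ w, v w = 0 := by
    intro u
    have := congrFun hz u
    rw [Matrix.mulVec, _root_.dotProduct] at this
    have e : ∀ w, circB n 1 1 u w * v w =
        (if w = u - 1 then v w else 0) - (if w = u then v w else 0) + v w := by
      intro w
      have i1 : u - w = 1 ↔ w = u - 1 := by
        constructor
        · intro e; rw [← e]; ring
        · intro e; rw [e]; ring
      simp only [circB, Matrix.of_apply, i1, eq_comm (a := u) (b := w)]
      split_ifs <;> ring
    rw [Finset.sum_congr rfl (fun w _ => e w), Finset.sum_add_distrib,
      Finset.sum_sub_distrib] at this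
    simpa using this
  have hs : ∑ w, v w = 0 := by
    have := Finset.sum_congr (rfl : (Finset.univ : Finset (ZMod n)) = _) (fun u _ => key u)
    rw [Finset.sum_add_distrib, Finset.sum_sub_distrib] at this
    have e : ∑ u, v (u - 1) = ∑ u, v u := (Equiv.subRight (1 : ZMod n)).sum_comp v
    rw [e] at this
    simpa [ZMod.card, hn] using this
  have hc : ∀ i : ℕ, v (i : ZMod n) = v 0 := by
    intro i
    induction i with
    | zero => simp
    | succ i ih =>
      have := key ((i + 1 : ℕ) : ZMod n)
      rw [hs] at this
      push_cast at this ⊢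
      rw [add_sub_cancel_right] at this
      linarith
  have hc' : ∀ x, v x = v 0 := by
    intro x
    have := hc x.val
    simpa using this
  apply hv
  rw [Finset.sum_congr rfl (fun w _ => hc' w)] at hs
  have : v 0 = 0 := by simpa [ZMod.card, hn] using hs
  ext x
  rw [hc' x, this]; rfl

lemma circInt_det (n h : ℕ) [NeZero n] (h0 : 0 < h) (hn : h < n) (hc : Nat.Coprime h n) :
    (circInt n h).det = h := by
  have := congrArg Matrix.det (circ_mul n h h0 hn)
  rw [Matrix.det_mul, circB_unit n h hc, circB_scale] at this
  exact mul_right_cancel₀ (circB_ne n) this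

lemma two_mul_zmod (p : ℕ) (hp : 0 < p) (w : ZMod (2 * p)) :
    2 * w = 0 ↔ w = 0 ∨ w = (p : ZMod (2*p)) := by
  have : NeZero (2 * p) := ⟨by omega⟩
  constructor
  · intro hw
    have e : ((2 * w.val : ℕ) : ZMod (2*p)) = 0 := by
      push_cast; simpa using hw
    rw [ZMod.natCast_eq_zero_iff] at e
    have hd : p ∣ w.val := Nat.dvd_of_mul_dvd_mul_left (by norm_num) e
    obtain ⟨c, hc⟩ := hd
    have hlt := w.val_lt
    have hc2 : c < 2 := by
      by_contra hcc
      have : p * 2 ≤ p * c := Nat.mul_le_mul_left _ (by omega)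
      omega
    have hw' : w = ((w.val : ℕ) : ZMod (2*p)) := by simp
    interval_cases c
    · left; rw [hw', hc]; simp
    · right; rw [hw', hc]; simp
  · rintro (rfl | rfl)
    · simp
    · have := ZMod.natCast_self (2 * p)
      push_cast at this
      exact this

lemma sign_refl (p e : ℕ) (hp : 0 < p) [NeZero (2*p)] (hpe : Odd (p + e)) :
    Equiv.Perm.sign (Equiv.subLeft (-(e : ZMod (2*p)))) = 1 := by
  have hsq : (Equiv.subLeft (-(e : ZMod (2*p))) : Equiv.Perm (ZMod (2*p))) ^ 2 = 1 := by
    ext x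
    simp [pow_two]
  rw [Equiv.Perm.sign_of_pow_two_eq_one hsq, ZMod.card]
  have hfix : ∀ v : ZMod (2*p), v ∈ Function.fixedPoints (Equiv.subLeft (-(e : ZMod (2*p)))) ↔
      2 * v + e = 0 := by
    intro v
    simp only [Function.mem_fixedPoints, Function.IsFixedPt, Equiv.subLeft_apply]
    constructor
    · intro h; linear_combination -h
    · intro h; linear_combination -h
  rcases Nat.even_or_odd e with he | he
  · obtain ⟨a, rfl⟩ := he
    have hpo : Odd p := by
      rcases Nat.even_or_odd p with h | h
      · exfalso; obtain ⟨c, hc⟩ := hpe; obtain ⟨d, hd⟩ := h; omega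
      · exact h
    have hset : Fintype.card (Function.fixedPoints
        (Equiv.subLeft (-((a + a : ℕ) : ZMod (2*p))))) = 2 := by
      rw [Fintype.card_eq_nat_card]
      have : Function.fixedPoints (Equiv.subLeft (-((a + a : ℕ) : ZMod (2*p)))) =
          ({-(a : ZMod (2*p)), -(a : ZMod (2*p)) + p} : Set (ZMod (2*p))) := by
        ext v
        rw [hfix v]
        have := two_mul_zmod p hp (v + a)
        rw [show 2 * v + ((a + a : ℕ) : ZMod (2*p)) = 2 * (v + a) by push_cast; ring, this]
        simp only [Set.mem_insert_iff, Set.mem_singleton_iff]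
        rw [eq_neg_iff_add_eq_zero, ← eq_sub_iff_add_eq, ← eq_sub_iff_add_eq, neg_add_eq_sub]
      rw [this, Nat.card_coe_set_eq, Set.ncard_pair]
      intro h
      have h2 : (p : ZMod (2*p)) = 0 := by linear_combination -h
      rw [ZMod.natCast_eq_zero_iff] at h2
      have := Nat.le_of_dvd hp h2
      omega
    rw [hset]
    apply Even.neg_one_pow
    obtain ⟨c, hc⟩ := hpo
    exact ⟨c, by omega⟩
  · have hset : Fintype.card (Function.fixedPoints
        (Equiv.subLeft (-(e : ZMod (2*p))))) = 0 := by
      rw [Fintype.card_eq_zero_iff]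
      constructor
      rintro ⟨v, hv⟩
      rw [hfix v] at hv
      have : ((2 * v.val + e : ℕ) : ZMod (2*p)) = 0 := by push_cast; simpa using hv
      rw [ZMod.natCast_eq_zero_iff] at this
      obtain ⟨c, hc⟩ := this
      obtain ⟨d, hd⟩ := he
      have : 2 * (p * c) = 2 * v.val + e := by rw [hc]; ring
      omega
    rw [hset]
    apply Even.neg_one_pow
    obtain ⟨c, hc⟩ := hpe
    obtain ⟨d, hd⟩ := he
    exact ⟨(c - d), by omega⟩

lemma finEquiv_eq (n : ℕ) [NeZero n] (i : Fin n) :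
    ZMod.finEquiv n i = ((i.1 : ℕ) : ZMod n) := by
  cases n with
  | zero => exact i.elim0
  | succ n => exact (Fin.cast_val_eq_self i).symm

lemma hankel_mech_det (p h e : ℕ) (h0 : 0 < h) (hn : h < 2 * p) (hc : Nat.Coprime h (2 * p))
    (hpe : Odd (p + e)) :
    (Matrix.of fun i j : Fin (2*p) =>
      if (h * (i.1 + j.1) + e) % (2 * p) < h then (1 : ℤ) else 0).det = h := by
  have hp : 0 < p := by omega
  have : NeZero (2 * p) := ⟨by omega⟩
  apply Int.cast_injective (α := ℚ)
  rw [Int.cast_det, Int.cast_natCast, ← circInt_det (2*p) h h0 hn hc]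
  rw [← one_mul (circInt (2*p) h).det]
  have hs := sign_refl p e hp hpe
  have := Matrix.det_permute' (Equiv.subLeft (-(e : ZMod (2*p)))) (circInt (2*p) h)
  rw [hs] at this
  simp only [Units.val_one, Int.cast_one] at this
  rw [← this, ← Matrix.det_submatrix_equiv_self
    ((ZMod.finEquiv (2*p)).toEquiv.trans (Units.mulLeft (ZMod.unitOfCoprime h hc)))]
  have hfin : ∀ i : Fin (2*p), ZMod.finEquiv (2*p) i = ((i.1 : ℕ) : ZMod (2*p)) :=
    fun i => finEquiv_eq (2*p) i
  congr 1
  ext i j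
  simp only [Matrix.map_apply, Matrix.of_apply, Matrix.submatrix_apply, Equiv.trans_apply,
    circInt, Equiv.subLeft_apply, Units.mulLeft_apply, RingEquiv.toEquiv_eq_coe,
    EquivLike.coe_coe, hfin, ZMod.coe_unitOfCoprime, id]
  have : (h : ZMod (2*p)) * (i.1 : ZMod (2*p)) - (-(e : ZMod (2*p)) - h * (j.1 : ZMod (2*p)))
      = ((h * (i.1 + j.1) + e : ℕ) : ZMod (2*p)) := by push_cast; ring
  rw [this, ZMod.val_natCast]
  split_ifs <;> simp

/-- Word image under tau. -/
def tauW (l : List ℕ) : List ℕ := (l.map tau).flatten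

lemma tauW_append (a b : List ℕ) : tauW (a ++ b) = tauW a ++ tauW b := by
  simp [tauW]

lemma tau_head (b : ℕ) : ∃ t, tau b = 1 :: t := by
  unfold tau; split_ifs <;> simp

lemma tauIter_mem (n x : ℕ) (hx : x ∈ tauIter n) : x ≤ 1 := by
  induction n with
  | zero => simp [tauIter] at hx; omega
  | succ n ih =>
    simp only [tauIter, List.mem_flatten, List.mem_map] at hx
    obtain ⟨l, ⟨b, _, rfl⟩, hx⟩ := hx
    unfold tau at hx
    split_ifs at hx <;> simp at hx <;> omega

lemma tauW_length (l : List ℕ) (hl : ∀ x ∈ l, x ≤ 1) :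
    (tauW l).length = l.length + 2 * l.sum := by
  induction l with
  | nil => simp [tauW]
  | cons a l ih =>
    have ih' := ih (fun x hx => hl x (by simp [hx]))
    have ha := hl a (by simp)
    have e : tauW (a :: l) = tau a ++ tauW l := by simp [tauW]
    rw [e, List.length_append, ih']
    have : a = 0 ∨ a = 1 := by omega
    rcases this with rfl | rfl <;> simp [tau] <;> omega

lemma tauIter_head (n : ℕ) : ∃ t, tauIter n = 1 :: t := by
  induction n with
  | zero => exact ⟨[], rfl⟩
  | succ n ih =>
    obtain ⟨t, ht⟩ := ih
    refine ⟨[0, 1] ++ tauW t, ?_⟩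
    simp [tauIter, ht, tau, tauW]

lemma tauIter_length (n : ℕ) : n < (tauIter n).length := by
  induction n with
  | zero => simp [tauIter]
  | succ n ih =>
    have e : tauIter (n+1) = tauW (tauIter n) := rfl
    rw [e, tauW_length _ (tauIter_mem n)]
    obtain ⟨t, ht⟩ := tauIter_head n
    rw [ht] at ih ⊢
    simp at ih ⊢
    omega

/-- Partial sums. -/
def SS (s : ℕ → ℕ) (j : ℕ) : ℕ := ∑ i ∈ Finset.range j, s i

/-- Image position. -/
def LL (s : ℕ → ℕ) (j : ℕ) : ℕ := j + 2 * SS s j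

lemma SS_succ (s : ℕ → ℕ) (j : ℕ) : SS s (j+1) = SS s j + s j := by
  simp [SS, Finset.sum_range_succ]

lemma take_sum (s : ℕ → ℕ) (l : List ℕ) (hl : ∀ i < l.length, s i = l.getD i 0) (j : ℕ)
    (hj : j ≤ l.length) : (l.take j).sum = SS s j := by
  induction j with
  | zero => simp [SS]
  | succ j ih =>
    rw [SS_succ, ← ih (by omega), hl j (by omega), List.sum_take_succ _ _ (by omega)]
    simp [List.getD_eq_getElem?_getD, List.getElem?_eq_getElem (show j < l.length by omega)]

lemma fixed_step (s : ℕ → ℕ) (hs : IsFixedSeq s) (j r : ℕ) (hr : r < (tau (s j)).length) :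
    s (LL s j + r) = (tau (s j)).getD r 0 := by
  set l := tauIter j with hl
  have hj : j < l.length := tauIter_length j
  have hsj : s j = l[j] := by
    rw [hs j j hj, List.getD_eq_getElem?_getD, List.getElem?_eq_getElem hj]; rfl
  have hsplit : tauIter (j+1) = tauW (l.take j) ++ (tau (s j) ++ tauW (l.drop (j+1))) := by
    have e : tauIter (j+1) = tauW l := rfl
    have e2 : l = l.take j ++ ([s j] ++ l.drop (j+1)) := by
      rw [hsj]; simp
    rw [e]
    conv_lhs => rw [e2]
    rw [tauW_append, tauW_append]
    simp [tauW]
  have hlen : (tauW (l.take j)).length = LL s j := by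
    rw [tauW_length _ (fun x hx => tauIter_mem j x (List.mem_of_mem_take hx)),
      take_sum s l (hs j) j hj.le]
    rw [List.length_take, Nat.min_eq_left hj.le, LL]
  have hlt : LL s j + r < (tauIter (j+1)).length := by
    rw [hsplit, List.length_append, List.length_append, hlen]; omega
  rw [hs (j+1) _ hlt, hsplit, List.getD_append_right _ _ _ _ (by omega), hlen,
    Nat.add_sub_cancel_left, List.getD_append _ _ _ _ hr]

lemma s_le (s : ℕ → ℕ) (hs : IsFixedSeq s) (j : ℕ) : s j ≤ 1 := by
  have hj := tauIter_length j
  rw [hs j j hj, List.getD_eq_getElem?_getD, List.getElem?_eq_getElem hj]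
  exact tauIter_mem j _ (List.getElem_mem _)

lemma s_LL (s : ℕ → ℕ) (hs : IsFixedSeq s) (j : ℕ) : s (LL s j) = 1 := by
  obtain ⟨t, ht⟩ := tau_head (s j)
  have := fixed_step s hs j 0 (by simp [ht])
  simpa [ht] using this

lemma s_LL1 (s : ℕ → ℕ) (hs : IsFixedSeq s) (j : ℕ) (h : s j = 1) : s (LL s j + 1) = 0 := by
  have := fixed_step s hs j 1 (by simp [h, tau])
  simpa [h, tau] using this

lemma s_LL2 (s : ℕ → ℕ) (hs : IsFixedSeq s) (j : ℕ) (h : s j = 1) : s (LL s j + 2) = 1 := by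
  have := fixed_step s hs j 2 (by simp [h, tau])
  simpa [h, tau] using this

lemma LL_succ (s : ℕ → ℕ) (j : ℕ) : LL s (j+1) = LL s j + 1 + 2 * s j := by
  simp only [LL, SS_succ]; omega

lemma s_LL_pred (s : ℕ → ℕ) (hs : IsFixedSeq s) (j : ℕ) : s (LL s (j+1) - 1) = 1 := by
  have := s_le s hs j
  have : s j = 0 ∨ s j = 1 := by omega
  rcases this with h | h
  · rw [LL_succ, h]; exact s_LL s hs j
  · rw [LL_succ, h]; exact s_LL2 s hs j h

lemma SS_LL (s : ℕ → ℕ) (hs : IsFixedSeq s) (j : ℕ) : SS s (LL s j) = j + SS s j := by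
  induction j with
  | zero => simp [LL, SS]
  | succ j ih =>
    have := s_le s hs j
    have : s j = 0 ∨ s j = 1 := by omega
    rcases this with h | h
    · rw [LL_succ, h, SS_succ s j, h]
      simp only [Nat.mul_zero, Nat.add_zero]
      rw [SS_succ, ih, s_LL s hs]; omega
    · rw [LL_succ, h, SS_succ s j, h]
      rw [show LL s j + 1 + 2 * 1 = LL s j + 1 + 1 + 1 by ring, SS_succ, SS_succ, SS_succ, ih,
        s_LL s hs, s_LL1 s hs j h, show LL s j + 1 + 1 = LL s j + 2 by ring, s_LL2 s hs j h]
      omega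

/-- Mechanical word letters. -/
def mech (n h e : ℕ) (j : ℕ) : ℕ := if (h * j + e) % n < h then 1 else 0

lemma mod_of_eq (n X y q : ℤ) (h : X = y + n * q) (h0 : 0 ≤ y) (h1 : y < n) : X % n = y := by
  rw [h, Int.add_mul_emod_self_left, Int.emod_eq_of_lt h0 h1]

lemma mech_one (n h e j : ℕ) (y q : ℤ) (hX : (h * j + e : ℤ) = y + n * q) (h0 : 0 ≤ y)
    (h1 : y < h) (hn : h ≤ n) : mech n h e j = 1 := by
  have := mod_of_eq n _ y q hX h0 (by omega)
  unfold mech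
  rw [if_pos]
  zify
  rw [this]; exact h1

lemma mech_zero (n h e j : ℕ) (y q : ℤ) (hX : (h * j + e : ℤ) = y + n * q) (h0 : (h:ℤ) ≤ y)
    (h1 : y < n) : mech n h e j = 0 := by
  have := mod_of_eq n _ y q hX (by omega) h1
  unfold mech
  rw [if_neg]
  zify
  rw [this]; omega

lemma window_aux (s : ℕ → ℕ) (hs : IsFixedSeq s) (m n h e : ℕ) (hm : 0 < m) (hn : h < n)
    (he : e + 1 ≤ h)
    (hw : ∀ j, j < 2 * n - 1 → s (m + j) = mech n h e j) (j : ℕ) (hj : j ≤ 2 * n - 1) :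
    ∃ (c : ℕ) (y : ℤ), 0 ≤ y ∧ y < n ∧ y = (h : ℤ) - 1 - e - h * j + n * c ∧
      LL s (m + j) = LL s m - 1 + (1 + j + 2 * c) ∧
      ∀ J, J < 1 + j + 2 * c →
        s (LL s m - 1 + J) = mech (n + 2 * h) (n + h) (2 * h - 1 - e) J := by
  have hpos : 0 < LL s m := by unfold LL; omega
  have hcast : ((2 * h - 1 - e : ℕ) : ℤ) = 2 * h - 1 - e := by omega
  induction j with
  | zero =>
    refine ⟨0, (h : ℤ) - 1 - e, by omega, by omega, by push_cast; ring, by simp; omega, ?_⟩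
    intro J hJ
    have : J = 0 := by omega
    subst this
    obtain ⟨m', rfl⟩ : ∃ m', m = m' + 1 := ⟨m - 1, by omega⟩
    rw [Nat.add_zero, s_LL_pred s hs]
    symm
    apply mech_one _ _ _ _ (2 * h - 1 - e : ℤ) 0
    · rw [hcast]; push_cast; ring
    · omega
    · push_cast; omega
    · omega
  | succ j ih =>
    obtain ⟨c, y, hy0, hyn, hy, hL, hJ⟩ := ih (by omega)
    have hsj := hw j (by omega)
    have hLs := LL_succ s (m + j)
    rw [show m + j + 1 = m + (j + 1) by ring] at hLs
    have hy' : (h : ℤ) * j = (h : ℤ) - 1 - e + n * c - y := by rw [hy]; ring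
    have phase : ∀ J : ℕ, ∀ r : ℤ, (J : ℤ) = 1 + j + 2 * c + r →
        (((n + h : ℕ) : ℤ) * J + ((2 * h - 1 - e : ℕ) : ℤ)) =
          y + (n + h) * r + ((n + 2 * h : ℕ) : ℤ) * (1 + j + c) := by
      intro J r hr
      rw [hcast, hr, hy]; push_cast; ring
    by_cases hc : y < h
    · have hs1 : s (m + j) = 1 := by
        rw [hsj]
        apply mech_one _ _ _ _ ((h : ℤ) - 1 - y) c _ (by omega) (by omega) hn.le
        rw [hy']; ring
      rw [hs1] at hLs
      refine ⟨c + 1, y + n - h, by omega, by omega, by rw [hy]; push_cast; ring, by omega, ?_⟩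
      intro J hJlt
      by_cases h1 : J < 1 + j + 2 * c
      · exact hJ J h1
      · obtain h2 | h2 | h2 : J = 1 + j + 2 * c ∨ J = 1 + j + 2 * c + 1 ∨ J = 1 + j + 2 * c + 2 := by
          omega
        · rw [h2, ← hL, s_LL s hs]
          symm
          apply mech_one _ _ _ _ y (1 + j + c) _ hy0 (by push_cast; omega) (by omega)
          rw [phase _ 0 (by push_cast; ring)]; push_cast; ring
        · rw [h2, ← add_assoc, ← hL, s_LL1 s hs _ hs1]
          symm
          apply mech_zero _ _ _ _ (y + (n + h)) (1 + j + c) _ (by push_cast; omega)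
            (by push_cast; omega)
          rw [phase _ 1 (by push_cast; ring)]; push_cast; ring
        · rw [h2, ← add_assoc, ← hL, s_LL2 s hs _ hs1]
          symm
          apply mech_one _ _ _ _ (y + n) (1 + j + c + 1) _ (by omega) (by push_cast; omega)
            (by omega)
          rw [phase _ 2 (by push_cast; ring)]; push_cast; ring
    · have hs0 : s (m + j) = 0 := by
        rw [hsj]
        apply mech_zero _ _ _ _ ((h : ℤ) - 1 - y + n) (c - 1) _ (by omega) (by omega)
        rw [hy']; ring
      rw [hs0] at hLs
      refine ⟨c, y - h, by omega, by omega, by rw [hy]; push_cast; ring, by omega, ?_⟩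
      intro J hJlt
      by_cases h1 : J < 1 + j + 2 * c
      · exact hJ J h1
      · have h2 : J = 1 + j + 2 * c := by omega
        rw [h2, ← hL, s_LL s hs]
        symm
        apply mech_one _ _ _ _ y (1 + j + c) _ hy0 (by push_cast; omega) (by omega)
        rw [phase _ 0 (by push_cast; ring)]; push_cast; ring

lemma window_step (s : ℕ → ℕ) (hs : IsFixedSeq s) (m n h e : ℕ) (hm : 0 < m) (hn : h < n)
    (he : e + 1 ≤ h)
    (hw : ∀ j, j < 2 * n - 1 → s (m + j) = mech n h e j) (J : ℕ)
    (hJ : J < 2 * (n + 2 * h) - 1) :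
    s (LL s m - 1 + J) = mech (n + 2 * h) (n + h) (2 * h - 1 - e) J := by
  obtain ⟨c, y, hy0, hyn, hy, hL, hall⟩ := window_aux s hs m n h e hm hn he hw (2 * n - 1) le_rfl
  have hcast : ((2 * h - 1 - e : ℕ) : ℤ) = 2 * h - 1 - e := by omega
  have hcast2 : ((2 * n - 1 : ℕ) : ℤ) = 2 * n - 1 := by omega
  have hc : 2 * h ≤ c + 1 := by
    by_contra hcc
    have h1 : (c : ℤ) + 2 ≤ 2 * h := by omega
    have h2 : (n : ℤ) * (c + 2) ≤ n * (2 * h) := mul_le_mul_of_nonneg_left h1 (by omega)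
    rw [hcast2] at hy
    have h3 : y = 2 * h - 1 - e + n * (c + 2) - n * (2 * h) - 2 * n := by rw [hy]; ring
    omega
  by_cases h1 : J < 1 + (2 * n - 1) + 2 * c
  · exact hall J h1
  · have h2 : J = 1 + (2 * n - 1) + 2 * c := by omega
    rw [h2, ← hL, s_LL s hs]
    symm
    apply mech_one _ _ _ _ y (1 + (2 * n - 1) + c) _ hy0 (by push_cast; omega) (by omega)
    push_cast
    rw [hcast, hcast2, hy, hcast2]; ring

/-- The inductive invariant. -/
lemma invariant (s : ℕ → ℕ) (hs : IsFixedSeq s) (f : ℕ → ℕ) (hf : IsFSeq f) (k : ℕ) :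
    ∃ p h e : ℕ, f (2*(k+1)) = h ∧ f (2*(k+1)+1) = 2 * p ∧ h < 2 * p ∧ e + 1 ≤ h ∧ Odd h ∧
      Nat.Coprime h (2 * p) ∧ Odd (p + e) ∧ 2 * SS s (p + 2 * h + 1) = 4 * p + h + 1 ∧
      ∀ j, j < 2 * (2 * p) - 1 → s (p + 2 * h + 1 + j) = mech (2 * p) h e j := by
  obtain ⟨f0, f1, fe, fo⟩ := hf
  induction k with
  | zero =>
    have f2 := fe 0
    have f3 := fo 0
    simp only [Nat.mul_zero, Nat.zero_add] at f2 f3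
    have hval : ∀ j, j < 17 → s j = (tauIter 3).getD j 0 := by
      intro j hj
      exact hs 3 j (by simpa [tauIter, tau] using hj)
    refine ⟨2, 3, 1, by simp; omega, by simp; omega, by norm_num, by norm_num, by decide,
      by decide, by decide, ?_, ?_⟩
    · have : SS s 9 = SS (fun j => (tauIter 3).getD j 0) 9 := by
        unfold SS
        apply Finset.sum_congr rfl
        intro i hi
        exact hval i (by simp at hi; omega)
      simp only [Nat.reduceMul, Nat.reduceAdd]
      rw [this]
      decide
    · intro j hj
      rw [hval _ (by omega)]
      have : j < 7 := by omega
      interval_cases j <;> decide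
  | succ k ih =>
    obtain ⟨p, h, e, hh, hp, hlt, he, hodd, hc, hpe, hS, hw⟩ := ih
    have g2 := fe (k + 1)
    have g3 := fo (k + 1)
    rw [show 2 * (k+1) + 2 = 2 * (k + 1 + 1) by ring] at g2 g3
    rw [show 2 * (k+1) + 3 = 2 * (k + 1 + 1) + 1 by ring] at g3
    have hLL : LL s (p + 2 * h + 1) - 1 = (p + h) + 2 * (2 * p + h) + 1 := by
      unfold LL; omega
    refine ⟨p + h, 2 * p + h, 2 * h - 1 - e, by omega, by omega, by omega, by omega, ?_, ?_, ?_,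
      ?_, ?_⟩
    · obtain ⟨d, hd⟩ := hodd
      exact ⟨p + d, by omega⟩
    · have h1 : Nat.Coprime (2 * p + h) h := by
        rw [Nat.coprime_add_self_left]; exact hc.symm
      rw [show 2 * (p + h) = h + (2 * p + h) by ring, Nat.coprime_add_self_right]
      exact h1
    · obtain ⟨d, hd⟩ := hodd
      obtain ⟨d', hd'⟩ := hpe
      rw [Nat.odd_iff]
      omega
    · rw [← hLL]
      have h1 := SS_LL s hs (p + 2 * h + 1)
      have h2 := s_LL_pred s hs (p + 2 * h)
      have h3 := SS_succ s (LL s (p + 2 * h + 1) - 1)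
      rw [show LL s (p + 2 * h + 1) - 1 + 1 = LL s (p + 2 * h + 1) by omega, h1, h2] at h3
      omega
    · intro j hj
      rw [← hLL, show 2 * (p + h) = 2 * p + 2 * h by ring]
      exact window_step s hs _ _ _ _ (by omega) hlt he hw j (by omega)

theorem lower_left_corner_T2 (f : ℕ → ℕ) (hf : IsFSeq f) (s : ℕ → ℕ) (hs : IsFixedSeq s) :
    ∀ k : ℕ, 1 ≤ k →
      H s (f (2*k+3) / 2 + f (2*k) + 1) (f (2*k+1)) = (f (2*k) : ℤ) := by
  intro k hk
  obtain ⟨k, rfl⟩ : ∃ k', k = k' + 1 := ⟨k - 1, by omega⟩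
  obtain ⟨p, h, e, hh, hp, hlt, he, hodd, hc, hpe, hS, hw⟩ := invariant s hs f hf k
  have g2 := hf.2.2.1 (k + 1)
  have g3 := hf.2.2.2 (k + 1)
  have hm : f (2*(k+1)+3) / 2 + f (2*(k+1)) + 1 = p + 2 * h + 1 := by omega
  rw [hm, hp, hh, ← hankel_mech_det p h e (by omega) hlt hc hpe]
  unfold H
  congr 1
  ext i j
  simp only [Matrix.of_apply]
  rw [add_assoc (p + 2 * h + 1), hw (i.1 + j.1) (by omega)]
  unfold mech
  split_ifs <;> simp
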